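/- Comparison principle on a bounded interval: Let 0 < R < ∞. Let ū be a super-solution and u̲ a sub-solution of (⋆) on (0,R), both extending continuously to R, such that: 0 ≤ ū, u̲ ≤ s_+ on (0,R); ū(r) = ᾱ·r^{γ_+} + o(r^{γ_+}) and u̲(r) = α̲·r^{γ_+} + o(r^{γ_+}) as r → 0, with ᾱ > 0; ū(R) = s_+ and u̲(R) ≤ s_+. Then ū(r) ≥ u̲(r) for all r ∈ (0,R); moreover, if ū(r₀) = u̲(r₀) for some r₀ ∈ (0,R), then ū ≡ u̲ on (0,R). -/

import Mathlib

open Set Filter Topology MeasureTheory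
open scoped ENNReal NNReal

/-- `γ₊ = ((1-p) + √((p-1)² + 4q))/2`, the positive root of `γ² + (p-1)γ - q = 0`. -/
noncomputable def gammaPlus (p q : ℝ) : ℝ :=
  ((1 - p) + Real.sqrt ((p - 1) ^ 2 + 4 * q)) / 2

/-- Condition (condF) on the nonlinearity `F` (with `0 < sp` recorded separately). -/
def CondF (F : ℝ → ℝ) (sp : ℝ) : Prop :=
  ContDiff ℝ 1 F ∧ F 0 = 0 ∧ F sp = 0 ∧
    (∀ t ∈ Set.Ioo 0 sp, F t < 0) ∧ (∀ t, sp < t → 0 < F t) ∧ 0 < deriv F sp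

/-- The ODE (⋆) `u'' + (p/r) u' - (q/r²) u = F(u)` holds at the point `r`. -/
def ODEAt (p q : ℝ) (F : ℝ → ℝ) (u : ℝ → ℝ) (r : ℝ) : Prop :=
  deriv (deriv u) r + (p / r) * deriv u r - (q / r ^ 2) * u r = F (u r)

/-- `ψ` is locally Lipschitz on the set `I`. -/
def LocLipOn (I : Set ℝ) (ψ : ℝ → ℝ) : Prop :=
  ∀ x ∈ I, ∃ K : ℝ≥0, ∃ t ∈ nhdsWithin x I, LipschitzOnWith K ψ t

/-- `ψ` is a locally Lipschitz, piecewise `C²` super-solution of (⋆) on `I`: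
outside a locally finite set `S` of jump points it is `C²` and satisfies
`ψ'' + (p/r)ψ' - (q/r²)ψ ≤ F(ψ)`, and at each jump point the one-sided
derivatives exist with `ψ'(r₀⁻) > ψ'(r₀⁺)`. -/
def IsSuperSolutionOn (p q : ℝ) (F : ℝ → ℝ) (I : Set ℝ) (ψ : ℝ → ℝ) : Prop :=
  LocLipOn I ψ ∧
    ∃ S : Set ℝ,
      (∀ x ∈ I, ∃ ε > 0, (S ∩ Set.Ioo (x - ε) (x + ε)).Finite) ∧
      (∀ x ∈ I \ S, ContDiffAt ℝ 2 ψ x ∧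
        deriv (deriv ψ) x + (p / x) * deriv ψ x - (q / x ^ 2) * ψ x ≤ F (ψ x)) ∧
      (∀ x ∈ I ∩ S, ∃ dl dr : ℝ, HasDerivWithinAt ψ dl (Set.Iio x) x ∧
        HasDerivWithinAt ψ dr (Set.Ioi x) x ∧ dr < dl)

/-- `ψ` is a locally Lipschitz, piecewise `C²` sub-solution of (⋆) on `I`. -/
def IsSubSolutionOn (p q : ℝ) (F : ℝ → ℝ) (I : Set ℝ) (ψ : ℝ → ℝ) : Prop :=
  LocLipOn I ψ ∧
    ∃ S : Set ℝ,
      (∀ x ∈ I, ∃ ε > 0, (S ∩ Set.Ioo (x - ε) (x + ε)).Finite) ∧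
      (∀ x ∈ I \ S, ContDiffAt ℝ 2 ψ x ∧
        F (ψ x) ≤ deriv (deriv ψ) x + (p / x) * deriv ψ x - (q / x ^ 2) * ψ x) ∧
      (∀ x ∈ I ∩ S, ∃ dl dr : ℝ, HasDerivWithinAt ψ dl (Set.Iio x) x ∧
        HasDerivWithinAt ψ dr (Set.Ioi x) x ∧ dl < dr)

/-- `u(r) = α·r^γ + o(r^γ)` as `r → 0⁺`. -/
def AsympZero (u : ℝ → ℝ) (α γ : ℝ) : Prop :=
  Filter.Tendsto (fun r : ℝ => (u r - α * r ^ γ) / r ^ γ) (nhdsWithin 0 (Set.Ioi 0)) (nhds 0)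

/-- `u(r) = sp - β·r⁻² + o(r⁻²)` as `r → ∞`. -/
def AsympInfty (u : ℝ → ℝ) (sp β : ℝ) : Prop :=
  Filter.Tendsto (fun r : ℝ => (u r - (sp - β / r ^ 2)) * r ^ 2) Filter.atTop (nhds 0)

/-- Pointwise super-solution condition: either `C²` with the differential inequality,
or a concave corner. -/
def SuperAt (p q : ℝ) (F ψ : ℝ → ℝ) (x : ℝ) : Prop :=
  (ContDiffAt ℝ 2 ψ x ∧
    deriv (deriv ψ) x + (p / x) * deriv ψ x - (q / x ^ 2) * ψ x ≤ F (ψ x)) ∨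
  ∃ dl dr : ℝ, HasDerivWithinAt ψ dl (Set.Iio x) x ∧
    HasDerivWithinAt ψ dr (Set.Ioi x) x ∧ dr < dl

/-- Pointwise sub-solution condition: either `C²` with the differential inequality,
or a convex corner. -/
def SubAt (p q : ℝ) (F ψ : ℝ → ℝ) (x : ℝ) : Prop :=
  (ContDiffAt ℝ 2 ψ x ∧
    F (ψ x) ≤ deriv (deriv ψ) x + (p / x) * deriv ψ x - (q / x ^ 2) * ψ x) ∨
  ∃ dl dr : ℝ, HasDerivWithinAt ψ dl (Set.Iio x) x ∧
    HasDerivWithinAt ψ dr (Set.Ioi x) x ∧ dl < dr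

lemma IsSuperSolutionOn.superAt {p q : ℝ} {F ψ : ℝ → ℝ} {I : Set ℝ}
    (h : IsSuperSolutionOn p q F I ψ) {x : ℝ} (hx : x ∈ I) : SuperAt p q F ψ x := by
  obtain ⟨-, S, -, h1, h2⟩ := h
  by_cases hS : x ∈ S
  · exact Or.inr (h2 x ⟨hx, hS⟩)
  · exact Or.inl (h1 x ⟨hx, hS⟩)

lemma IsSubSolutionOn.subAt {p q : ℝ} {F ψ : ℝ → ℝ} {I : Set ℝ}
    (h : IsSubSolutionOn p q F I ψ) {x : ℝ} (hx : x ∈ I) : SubAt p q F ψ x := by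
  obtain ⟨-, S, -, h1, h2⟩ := h
  by_cases hS : x ∈ S
  · exact Or.inr (h2 x ⟨hx, hS⟩)
  · exact Or.inl (h1 x ⟨hx, hS⟩)

lemma LocLipOn.continuousOn {I : Set ℝ} {ψ : ℝ → ℝ} (h : LocLipOn I ψ) : ContinuousOn ψ I := by
  intro x hx
  obtain ⟨K, t, ht, hK⟩ := h x hx
  have hxt : x ∈ t := mem_of_mem_nhdsWithin hx ht
  exact (hK.continuousOn x hxt).mono_of_mem_nhdsWithin ht

/-- Dilating a super-solution by `c ≥ 1` gives a super-solution wherever `F ≤ 0`. -/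
lemma SuperAt.dilate {p q : ℝ} {F ψ : ℝ → ℝ} {c x : ℝ} (hc : 1 ≤ c) (hx : 0 < x)
    (hF : F (ψ (c * x)) ≤ 0) (h : SuperAt p q F ψ (c * x)) :
    SuperAt p q F (fun y => ψ (c * y)) x := by
  have hc0 : 0 < c := by linarith
  rcases h with ⟨hC, hle⟩ | ⟨dl, dr, hl, hr, hlt⟩
  · refine Or.inl ⟨?_, ?_⟩
    · exact ContDiffAt.comp x hC (contDiffAt_const.mul contDiffAt_id)
    · have h1 : deriv (fun y => ψ (c * y)) = fun y => c * deriv ψ (c * y) := by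
        funext y
        simpa using deriv_comp_mul_left c ψ y
      have h2 : deriv (deriv (fun y => ψ (c * y))) x = c * (c * deriv (deriv ψ) (c * x)) := by
        rw [h1, deriv_const_mul_field, deriv_comp_mul_left c (deriv ψ) x, smul_eq_mul]
      rw [h2, h1]
      have h3 : c * (c * deriv (deriv ψ) (c * x)) + p / x * (c * deriv ψ (c * x)) -
          q / x ^ 2 * ψ (c * x) = c ^ 2 * (deriv (deriv ψ) (c * x) +
            p / (c * x) * deriv ψ (c * x) - q / (c * x) ^ 2 * ψ (c * x)) := by
        field_simp
      simp only [h3]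
      have h4 := mul_le_mul_of_nonneg_left hle (sq_nonneg c)
      have h5 : 0 ≤ (c ^ 2 - 1) * -F (ψ (c * x)) :=
        mul_nonneg (by nlinarith) (by linarith)
      linarith
  · refine Or.inr ⟨dl * c, dr * c, ?_, ?_, by nlinarith⟩
    · refine HasDerivWithinAt.comp x (h₂ := ψ) (h := fun y => c * y) (s' := Iio (c * x)) hl ?_ ?_
      · simpa using ((hasDerivAt_id x).const_mul c).hasDerivWithinAt
      · intro y hy
        exact mul_lt_mul_of_pos_left hy hc0
    · refine HasDerivWithinAt.comp x (h₂ := ψ) (h := fun y => c * y) (s' := Ioi (c * x)) hr ?_ ?_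
      · simpa using ((hasDerivAt_id x).const_mul c).hasDerivWithinAt
      · intro y hy
        exact mul_lt_mul_of_pos_left hy hc0

lemma IsLocalMin.nonneg_of_hasDerivAt {g g' : ℝ → ℝ} {d x : ℝ} (h : IsLocalMin g x)
    (hg : ∀ᶠ y in 𝓝 x, HasDerivAt g (g' y) y) (hg' : HasDerivAt g' d x) : 0 ≤ d := by
  by_contra! hd
  have h1 : deriv g =ᶠ[𝓝 x] g' := hg.mono fun y hy => hy.deriv
  have h2 : deriv (deriv g) x = d := by rw [h1.deriv_eq, hg'.deriv]
  have hmax : IsLocalMax g x := isLocalMax_of_deriv_deriv_neg (by linarith) h.deriv_eq_zero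
    hg.self_of_nhds.continuousAt
  have h3 : g =ᶠ[𝓝 x] fun _ => g x := by
    filter_upwards [h, hmax] with y hy1 hy2
    exact le_antisymm hy2 hy1
  have h4 : deriv (deriv g) x = 0 := by
    have : deriv g =ᶠ[𝓝 x] fun _ => 0 := by
      have := h3.deriv
      simpa using this
    rw [this.deriv_eq]
    simp
  linarith

lemma IsLocalMinOn.mul_sub_nonneg {g : ℝ → ℝ} {s : Set ℝ} {d x y : ℝ} (h : IsLocalMinOn g s x)
    (hg : HasDerivWithinAt g d s x) (hs : segment ℝ x y ⊆ s) : 0 ≤ d * (y - x) := by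
  have := h.hasFDerivWithinAt_nonneg hg.hasFDerivWithinAt
    (sub_mem_posTangentConeAt_of_segment_subset hs)
  simpa [mul_comm] using this

lemma IsLocalMin.left_deriv_nonpos {g : ℝ → ℝ} {d x : ℝ} (h : IsLocalMin g x)
    (hg : HasDerivWithinAt g d (Iio x) x) : d ≤ 0 := by
  have := (h.on (Iic x)).mul_sub_nonneg (y := x - 1) hg.Iic_of_Iio
    (by rw [segment_symm, segment_eq_Icc (by linarith)]; exact Icc_subset_Iic_self)
  linarith

lemma IsLocalMin.right_deriv_nonneg {g : ℝ → ℝ} {d x : ℝ} (h : IsLocalMin g x)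
    (hg : HasDerivWithinAt g d (Ioi x) x) : 0 ≤ d := by
  have := (h.on (Ici x)).mul_sub_nonneg (y := x + 1) hg.Ici_of_Ioi
    (by rw [segment_eq_Icc (by linarith)]; exact Icc_subset_Ici_self)
  linarith

lemma ContDiffAt.eventually_hasDerivAt_deriv {ψ : ℝ → ℝ} {x : ℝ} (h : ContDiffAt ℝ 2 ψ x) :
    (∀ᶠ y in 𝓝 x, HasDerivAt ψ (deriv ψ y) y) ∧
      HasDerivAt (deriv ψ) (deriv (deriv ψ) x) x := by
  constructor
  · filter_upwards [h.eventually (by simp)] with y hy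
    exact (hy.differentiableAt (by norm_num)).hasDerivAt
  · have h1 : ContDiffAt ℝ 1 (deriv ψ) x := ContDiffAt.derivWithin h (by norm_num)
    exact (h1.differentiableAt (by norm_num)).hasDerivAt

/-- At an interior minimum of `U - v - φ`, with `U` a super-solution, `v` a sub-solution and `φ`
twice differentiable, both `U` and `v` are `C²` and the differential inequalities combine. -/
lemma SuperAt.of_isLocalMin {p q : ℝ} {F U v φ φ' : ℝ → ℝ} {d x : ℝ}
    (hU : SuperAt p q F U x) (hv : SubAt p q F v x)
    (hφ : ∀ᶠ y in 𝓝 x, HasDerivAt φ (φ' y) y) (hφ' : HasDerivAt φ' d x)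
    (hmin : IsLocalMin (fun y => U y - v y - φ y) x) :
    ContDiffAt ℝ 2 U x ∧ ContDiffAt ℝ 2 v x ∧
      d + p / x * φ' x - q / x ^ 2 * (U x - v x) ≤ F (U x) - F (v x) := by
  have hφx := hφ.self_of_nhds
  have key : ∀ a b a' b' : ℝ, HasDerivWithinAt U a (Iio x) x → HasDerivWithinAt U b (Ioi x) x →
      HasDerivWithinAt v a' (Iio x) x → HasDerivWithinAt v b' (Ioi x) x →
      a - a' ≤ b - b' := by
    intro a b a' b' h1 h2 h3 h4
    have h5 := hmin.left_deriv_nonpos ((h1.sub h3).sub hφx.hasDerivWithinAt)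
    have h6 := hmin.right_deriv_nonneg ((h2.sub h4).sub hφx.hasDerivWithinAt)
    linarith
  rcases hU with ⟨hUC, hUle⟩ | ⟨a, b, ha, hb, hab⟩
  · have hU1 := (hUC.differentiableAt (by norm_num)).hasDerivAt
    rcases hv with ⟨hvC, hvle⟩ | ⟨a', b', ha', hb', hab'⟩
    · refine ⟨hUC, hvC, ?_⟩
      obtain ⟨hU1, hU2⟩ := hUC.eventually_hasDerivAt_deriv
      obtain ⟨hv1, hv2⟩ := hvC.eventually_hasDerivAt_deriv
      have hg : ∀ᶠ y in 𝓝 x, HasDerivAt (fun y => U y - v y - φ y)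
          (deriv U y - deriv v y - φ' y) y := by
        filter_upwards [hU1, hv1, hφ] with y h1 h2 h3
        exact (h1.sub h2).sub h3
      have h0 := hmin.hasDerivAt_eq_zero hg.self_of_nhds
      have h2 := hmin.nonneg_of_hasDerivAt hg ((hU2.sub hv2).sub hφ')
      have h3 : φ' x = deriv U x - deriv v x := by linarith
      rw [h3]
      linear_combination hUle + hvle + h2
    · have := key _ _ _ _ hU1.hasDerivWithinAt hU1.hasDerivWithinAt ha' hb'
      linarith
  · rcases hv with ⟨hvC, hvle⟩ | ⟨a', b', ha', hb', hab'⟩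
    · have hv1 := (hvC.differentiableAt (by norm_num)).hasDerivAt
      have := key _ _ _ _ ha hb hv1.hasDerivWithinAt hv1.hasDerivWithinAt
      linarith
    · have := key _ _ _ _ ha hb ha' hb'
      linarith

/-- Comparison of `U - v` with a strict sub-solution `φ` of the linearized inequality. -/
lemma barrier_le {p q K a b : ℝ} {F U v φ φ' φ'' : ℝ → ℝ} (hq : 0 < q) (hK0 : 0 ≤ K)
    (hUc : ContinuousOn U (Icc a b)) (hvc : ContinuousOn v (Icc a b))
    (hU : ∀ x ∈ Ioo a b, SuperAt p q F U x) (hv : ∀ x ∈ Ioo a b, SubAt p q F v x)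
    (hK : ∀ x ∈ Ioo a b, F (U x) - F (v x) ≤ K * (U x - v x))
    (hφc : ContinuousOn φ (Icc a b))
    (hφ : ∀ x ∈ Ioo a b, HasDerivAt φ (φ' x) x) (hφ' : ∀ x ∈ Ioo a b, HasDerivAt φ' (φ'' x) x)
    (hL : ∀ x ∈ Ioo a b, K * φ x < φ'' x + p / x * φ' x - q / x ^ 2 * φ x)
    (ha : φ a ≤ U a - v a) (hb : φ b ≤ U b - v b) :
    ∀ x ∈ Icc a b, φ x ≤ U x - v x := by
  intro c hc
  by_contra! hlt
  obtain ⟨x, hx, hmin⟩ := isCompact_Icc.exists_isMinOn ⟨c, hc⟩ ((hUc.sub hvc).sub hφc)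
  have hxc : U x - v x - φ x ≤ U c - v c - φ c := hmin hc
  have hxI : x ∈ Ioo a b := by
    refine ⟨lt_of_le_of_ne hx.1 ?_, lt_of_le_of_ne hx.2 ?_⟩ <;> rintro rfl <;> linarith
  obtain ⟨-, -, h⟩ := (hU x hxI).of_isLocalMin (hv x hxI)
    (eventually_of_mem (isOpen_Ioo.mem_nhds hxI) hφ) (hφ' x hxI)
    (hmin.isLocalMin (Icc_mem_nhds hxI.1 hxI.2))
  have h1 := hK x hxI
  have h2 := hL x hxI
  have h3 : K * (U x - v x) ≤ K * φ x := mul_le_mul_of_nonneg_left (by linarith) hK0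
  have h4 : q / x ^ 2 * (U x - v x) ≤ q / x ^ 2 * φ x :=
    mul_le_mul_of_nonneg_left (by linarith) (by positivity)
  linarith

/-- Strong maximum principle: ordered super- and sub-solutions that touch coincide. -/
lemma eq_of_touch {p q K ρ : ℝ} {F U v : ℝ → ℝ} (hp : 0 ≤ p) (hq : 0 < q) (hK0 : 0 ≤ K)
    (hUc : ContinuousOn U (Ioo 0 ρ)) (hvc : ContinuousOn v (Ioo 0 ρ))
    (hU : ∀ x ∈ Ioo 0 ρ, SuperAt p q F U x) (hv : ∀ x ∈ Ioo 0 ρ, SubAt p q F v x)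
    (hK : ∀ x ∈ Ioo 0 ρ, F (U x) - F (v x) ≤ K * (U x - v x))
    (hle : ∀ x ∈ Ioo 0 ρ, v x ≤ U x) {z : ℝ} (hz : z ∈ Ioo 0 ρ) (hUz : U z = v z)
    {a : ℝ} (ha : a ∈ Ioo 0 ρ) : U a = v a := by
  by_contra hne
  have hpos : 0 < U a - v a := sub_pos.2 (lt_of_le_of_ne (hle a ha) (Ne.symm hne))
  have haz : a ≠ z := by rintro rfl; exact hne hUz
  set m := min a z with hm
  set M := max a z with hM
  have hm0 : 0 < m := lt_min ha.1 hz.1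
  have hsub : Icc m M ⊆ Ioo 0 ρ := fun x hx =>
    ⟨hm0.trans_le hx.1, hx.2.trans_lt (max_lt ha.2 hz.2)⟩
  have hsub' : Ioo m M ⊆ Ioo 0 ρ := Ioo_subset_Icc_self.trans hsub
  set P := p / m with hP
  set Q := q / m ^ 2 with hQ
  have hP0 : 0 ≤ P := by positivity
  have hQ0 : 0 < Q := by positivity
  set B := P + Q + K + 1 with hB
  obtain ⟨β, hβ2, hβB, hβ⟩ : ∃ β : ℝ, β ^ 2 = B ^ 2 ∧ -B ≤ β ∧ 0 < β * (a - z) := by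
    rcases lt_or_gt_of_ne haz with h | h
    · exact ⟨-B, by ring, le_rfl, mul_pos_of_neg_of_neg (by linarith) (by linarith)⟩
    · exact ⟨B, by ring, by linarith, mul_pos (by linarith) (by linarith)⟩
  have hexp : 0 < Real.exp (β * a) - Real.exp (β * z) :=
    sub_pos.2 (Real.exp_lt_exp.2 (by linarith))
  set ε := (U a - v a) / (Real.exp (β * a) - Real.exp (β * z)) with hε
  have hε0 : 0 < ε := div_pos hpos hexp
  have hφ : ∀ x, HasDerivAt (fun y => ε * (Real.exp (β * y) - Real.exp (β * z)))
      (ε * (β * Real.exp (β * x))) x := by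
    intro x
    have h1 : HasDerivAt (fun y => Real.exp (β * y)) (Real.exp (β * x) * (β * 1)) x :=
      ((hasDerivAt_id x).const_mul β).exp
    exact ((h1.sub_const (Real.exp (β * z))).const_mul ε).congr_deriv (by ring)
  have hφ' : ∀ x, HasDerivAt (fun y => ε * (β * Real.exp (β * y)))
      (ε * (β ^ 2 * Real.exp (β * x))) x := by
    intro x
    have h1 : HasDerivAt (fun y => Real.exp (β * y)) (Real.exp (β * x) * (β * 1)) x :=
      ((hasDerivAt_id x).const_mul β).exp
    exact ((h1.const_mul β).const_mul ε).congr_deriv (by ring)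
  have hfa : ε * (Real.exp (β * a) - Real.exp (β * z)) ≤ U a - v a :=
    (div_mul_cancel₀ _ hexp.ne').le
  have hfz : ε * (Real.exp (β * z) - Real.exp (β * z)) ≤ U z - v z := by
    rw [hUz]; simp
  have hbar := barrier_le (φ := fun y => ε * (Real.exp (β * y) - Real.exp (β * z)))
    (φ' := fun y => ε * (β * Real.exp (β * y))) (φ'' := fun y => ε * (β ^ 2 * Real.exp (β * y)))
    hq hK0 (hUc.mono hsub) (hvc.mono hsub)
    (fun x hx => hU x (hsub' hx)) (fun x hx => hv x (hsub' hx)) (fun x hx => hK x (hsub' hx))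
    (fun x _ => (hφ x).continuousAt.continuousWithinAt) (fun x _ => hφ x) (fun x _ => hφ' x)
    (by
      intro x hx
      have hx0 : 0 < x := hm0.trans hx.1
      have h1 : p / x ≤ P := by rw [hP]; gcongr; exact hx.1.le
      have h2 : q / x ^ 2 ≤ Q := by rw [hQ]; gcongr; exact hx.1.le
      have h0 : 0 ≤ p / x := by positivity
      have h3 : -(P * B) ≤ p / x * β := by nlinarith
      have h4 : 0 < β ^ 2 + p / x * β - q / x ^ 2 - K := by
        rw [hβ2]; nlinarith
      have h5 : 0 ≤ (q / x ^ 2 + K) * Real.exp (β * z) := by positivity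
      have h6 := mul_pos h4 (Real.exp_pos (β * x))
      have h7 := mul_pos hε0 (add_pos_of_pos_of_nonneg h6 h5)
      linear_combination h7)
    (by rcases min_choice a z with h | h <;> rw [hm, h] <;> assumption)
    (by rcases max_choice a z with h | h <;> rw [hM, h] <;> assumption)
  have hminz : IsLocalMin (fun y => U y - v y - 0) z := by
    filter_upwards [isOpen_Ioo.mem_nhds hz] with y hy
    have := hle y hy
    simp only [hUz]
    linarith
  obtain ⟨hUC, hvC, -⟩ := (hU z hz).of_isLocalMin (hv z hz) (φ := fun _ => 0) (φ' := fun _ => 0)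
    (Eventually.of_forall fun y => hasDerivAt_const y 0) (hasDerivAt_const z 0) hminz
  have hd1 := (hUC.differentiableAt (by norm_num)).hasDerivAt.sub
    (hvC.differentiableAt (by norm_num)).hasDerivAt
  have hd0 : deriv U z - deriv v z = 0 := by
    have := hminz.hasDerivAt_eq_zero (hd1.sub (hasDerivAt_const z (0 : ℝ)))
    linarith
  have hd := hd1.sub (hφ z)
  rw [hd0] at hd
  have hmz : IsMinOn ((U - v) - fun y => ε * (Real.exp (β * y) - Real.exp (β * z)))
      (Icc m M) z := by
    intro y hy
    have := hbar y hy
    simp only [mem_ofPred_eq, Pi.sub_apply, hUz]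
    linarith
  have hfin := hmz.localize.mul_sub_nonneg (y := a) hd.hasDerivWithinAt
    (by rw [segment_symm, segment_eq_uIcc]; exact Subset.rfl)
  have := mul_pos (mul_pos hε0 hβ) (Real.exp_pos (β * z))
  linarith

/-- Hopf-type lemma at the singular endpoint `0`. -/
lemma exists_rpow_le_sub {p q K ρ γ : ℝ} {F U v : ℝ → ℝ} (hp : 0 ≤ p) (hq : 0 < q) (hK0 : 0 ≤ K)
    (hρ : 0 < ρ) (hγ : 0 < γ) (hγeq : γ ^ 2 + (p - 1) * γ - q = 0)
    (hUc : ContinuousOn U (Ioo 0 ρ)) (hvc : ContinuousOn v (Ioo 0 ρ))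
    (hU : ∀ x ∈ Ioo 0 ρ, SuperAt p q F U x) (hv : ∀ x ∈ Ioo 0 ρ, SubAt p q F v x)
    (hK : ∀ x ∈ Ioo 0 ρ, F (U x) - F (v x) ≤ K * (U x - v x))
    (hlt : ∀ x ∈ Ioo 0 ρ, v x < U x) :
    ∃ ε > 0, ∀ᶠ r in 𝓝[>] (0 : ℝ), ε * r ^ γ ≤ U r - v r := by
  obtain ⟨δ, hδ0, hδρ, hδ1, hδK⟩ : ∃ δ : ℝ, 0 < δ ∧ δ < ρ ∧ δ ≤ 1 ∧ δ * (K + 1) ≤ γ := by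
    refine ⟨min (ρ / 2) (min 1 (γ / (K + 1))), by positivity, ?_, ?_, ?_⟩
    · exact (min_le_left _ _).trans_lt (by linarith)
    · exact (min_le_right _ _).trans (min_le_left _ _)
    · rw [← le_div_iff₀ (by positivity)]
      exact (min_le_right _ _).trans (min_le_right _ _)
  have hδ : 0 < U δ - v δ := sub_pos.2 (hlt δ ⟨hδ0, hδρ⟩)
  have hden : 0 < δ ^ γ + δ ^ (γ + 1) := by positivity
  set ε := (U δ - v δ) / (δ ^ γ + δ ^ (γ + 1)) with hε
  have hε0 : 0 < ε := div_pos hδ hden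
  have hmain : ∀ μ > 0, ∀ r ∈ Ioo 0 δ, ε * (r ^ γ + r ^ (γ + 1)) - μ ≤ U r - v r := by
    intro μ hμ r hr
    have htend : Tendsto (fun y : ℝ => ε * (y ^ γ + y ^ (γ + 1))) (𝓝[>] 0) (𝓝 0) := by
      have h1 : ContinuousAt (fun y : ℝ => ε * (y ^ γ + y ^ (γ + 1))) 0 :=
        continuousAt_const.mul ((Real.continuousAt_rpow_const 0 γ (Or.inr hγ.le)).add
          (Real.continuousAt_rpow_const 0 (γ + 1) (Or.inr (by linarith))))
      have h2 := h1.tendsto.mono_left (nhdsWithin_le_nhds (s := Ioi 0))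
      simpa [Real.zero_rpow hγ.ne', Real.zero_rpow (show γ + 1 ≠ 0 by linarith)] using h2
    obtain ⟨η, hημ, hη0, hηr⟩ :=
      ((htend.eventually (gt_mem_nhds hμ)).and (Ioo_mem_nhdsGT hr.1)).exists
    have hsub : Icc η δ ⊆ Ioo 0 ρ := fun x hx => ⟨hη0.trans_le hx.1, hx.2.trans_lt hδρ⟩
    have hsub' : Ioo η δ ⊆ Ioo 0 ρ := Ioo_subset_Icc_self.trans hsub
    have hpow : ∀ x s : ℝ, 0 < x → HasDerivAt (fun y : ℝ => y ^ s) (s * x ^ (s - 1)) x :=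
      fun x s hx => Real.hasDerivAt_rpow_const (Or.inl hx.ne')
    have hφ : ∀ x, 0 < x → HasDerivAt (fun y : ℝ => ε * (y ^ γ + y ^ (γ + 1)) - μ)
        (ε * (γ * x ^ (γ - 1) + (γ + 1) * x ^ γ)) x := by
      intro x hx
      have := (((hpow x γ hx).add (hpow x (γ + 1) hx)).const_mul ε).sub_const μ
      simpa using this
    have hφ' : ∀ x, 0 < x → HasDerivAt (fun y : ℝ => ε * (γ * y ^ (γ - 1) + (γ + 1) * y ^ γ))
        (ε * (γ * ((γ - 1) * x ^ (γ - 2)) + (γ + 1) * (γ * x ^ (γ - 1)))) x := by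
      intro x hx
      have := (((hpow x (γ - 1) hx).const_mul γ).add ((hpow x γ hx).const_mul (γ + 1))).const_mul ε
      rw [show γ - 1 - 1 = γ - 2 by ring] at this
      exact this
    refine barrier_le hq hK0 (hUc.mono hsub) (hvc.mono hsub)
      (fun x hx => hU x (hsub' hx)) (fun x hx => hv x (hsub' hx)) (fun x hx => hK x (hsub' hx))
      (fun x hx => (hφ x (hsub hx).1).continuousAt.continuousWithinAt)
      (fun x hx => hφ x (hsub' hx).1) (fun x hx => hφ' x (hsub' hx).1) ?_ ?_ ?_ r
      ⟨hηr.le, hr.2.le⟩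
    · intro x hx
      have hx0 : 0 < x := (hsub' hx).1
      have e1 : x ^ (γ - 1) = x ^ (γ - 2) * x := by
        rw [← Real.rpow_add_one hx0.ne']; congr 1; ring
      have e2 : x ^ γ = x ^ (γ - 2) * x ^ 2 := by
        rw [← Real.rpow_add_natCast hx0.ne']; congr 1; push_cast; ring
      have e3 : x ^ (γ + 1) = x ^ (γ - 2) * x ^ 3 := by
        rw [← Real.rpow_add_natCast hx0.ne']; congr 1; push_cast; ring
      rw [e1, e2, e3]
      set s := x ^ (γ - 2) with hs
      have hs0 : 0 < s := by positivity
      have hq' : q = γ ^ 2 + (p - 1) * γ := by linarith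
      have hxK : K * x + K * x ^ 2 < 2 * γ + p := by
        have h1 : x * (K + 1) < γ := (mul_lt_mul_of_pos_right hx.2 (by linarith)).trans_le hδK
        have h2 : x ≤ 1 := hx.2.le.trans hδ1
        have h3 : K * x ^ 2 ≤ K * x := mul_le_mul_of_nonneg_left (by nlinarith) hK0
        nlinarith
      have h1 : 0 < ε * (s * x * (2 * γ + p - K * x - K * x ^ 2)) := by
        have : 0 < 2 * γ + p - K * x - K * x ^ 2 := by linarith
        positivity
      have h2 : 0 < q / x ^ 2 * μ := by positivity
      have h3 : 0 ≤ K * μ := by positivity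
      have h4 : ε * (γ * ((γ - 1) * s) + (γ + 1) * (γ * (s * x))) +
          p / x * (ε * (γ * (s * x) + (γ + 1) * (s * x ^ 2))) -
          q / x ^ 2 * (ε * (s * x ^ 2 + s * x ^ 3) - μ) =
          ε * (s * x * (2 * γ + p)) + q / x ^ 2 * μ := by
        field_simp
        rw [hq']
        ring
      rw [h4]
      linarith
    · have := hlt η ⟨hη0, (hηr.trans hr.2).trans hδρ⟩
      linarith
    · have : ε * (δ ^ γ + δ ^ (γ + 1)) = U δ - v δ := div_mul_cancel₀ _ hden.ne'
      linarith
  refine ⟨ε, hε0, ?_⟩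
  filter_upwards [Ioo_mem_nhdsGT hδ0] with r hr
  have h1 : ε * (r ^ γ + r ^ (γ + 1)) ≤ U r - v r :=
    le_of_forall_pos_le_add fun μ hμ => by linarith [hmain μ hμ r hr]
  have h2 : 0 ≤ ε * r ^ (γ + 1) := mul_nonneg hε0.le (Real.rpow_nonneg hr.1.le _)
  linarith

lemma gammaPlus_pos {p q : ℝ} (hq : 0 < q) : 0 < gammaPlus p q := by
  have : |p - 1| < Real.sqrt ((p - 1) ^ 2 + 4 * q) := by
    rw [← Real.sqrt_sq_eq_abs]
    exact Real.sqrt_lt_sqrt (sq_nonneg _) (by linarith)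
  have := le_abs_self (p - 1)
  unfold gammaPlus
  linarith

lemma gammaPlus_eq {p q : ℝ} (hq : 0 < q) :
    gammaPlus p q ^ 2 + (p - 1) * gammaPlus p q - q = 0 := by
  have := Real.sq_sqrt (show 0 ≤ (p - 1) ^ 2 + 4 * q by positivity)
  unfold gammaPlus
  linear_combination this / 4

lemma AsympZero.tendsto_div {u : ℝ → ℝ} {α γ : ℝ} (h : AsympZero u α γ) :
    Tendsto (fun r => u r / r ^ γ) (𝓝[>] 0) (𝓝 α) := by
  have h1 := h.add_const α
  rw [zero_add] at h1
  refine h1.congr' ?_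
  filter_upwards [self_mem_nhdsWithin] with r hr
  have : 0 < r ^ γ := Real.rpow_pos_of_pos hr γ
  field_simp
  ring

lemma AsympZero.tendsto_comp_mul_div {u : ℝ → ℝ} {α γ c : ℝ} (h : AsympZero u α γ) (hc : 0 < c) :
    Tendsto (fun r => u (c * r) / r ^ γ) (𝓝[>] 0) (𝓝 (α * c ^ γ)) := by
  have hmul : Tendsto (fun r : ℝ => c * r) (𝓝[>] 0) (𝓝[>] 0) := by
    refine tendsto_nhdsWithin_iff.2 ⟨?_, ?_⟩
    · have : ContinuousAt (fun r : ℝ => c * r) 0 := by fun_prop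
      simpa using this.tendsto.mono_left (nhdsWithin_le_nhds (s := Ioi 0))
    · filter_upwards [self_mem_nhdsWithin] with r hr using mul_pos hc hr
  refine ((h.tendsto_div.comp hmul).mul_const (c ^ γ)).congr' ?_
  filter_upwards [self_mem_nhdsWithin] with r hr
  have h1 : 0 < r ^ γ := Real.rpow_pos_of_pos hr γ
  have h2 : 0 < c ^ γ := Real.rpow_pos_of_pos hc γ
  simp only [Function.comp_apply]
  rw [Real.mul_rpow hc.le (le_of_lt hr)]
  field_simp

lemma ContDiff.exists_sub_le_mul_sub {F : ℝ → ℝ} (hF : ContDiff ℝ 1 F) (b : ℝ) :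
    ∃ K : ℝ, 0 ≤ K ∧ ∀ s t, 0 ≤ t → t ≤ s → s ≤ b → F s - F t ≤ K * (s - t) := by
  obtain ⟨K, hK⟩ := (hF.locallyLipschitz.locallyLipschitzOn
    (s := Icc 0 b)).exists_lipschitzOnWith_of_compact isCompact_Icc
  refine ⟨K, K.2, fun s t ht hts hs => ?_⟩
  have := hK.dist_le_mul s ⟨ht.trans hts, hs⟩ t ⟨ht, hts.trans hs⟩
  rw [Real.dist_eq, Real.dist_eq, abs_of_nonneg (sub_nonneg.2 hts)] at this
  exact (le_abs_self _).trans this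

/-- A sub-solution bounded by a zero `b > 0` of `F` stays strictly below it. -/
lemma SubAt.lt_of_eventually_le {p q b x : ℝ} {F v : ℝ → ℝ} (hq : 0 < q) (hb : 0 < b)
    (hx : 0 < x) (hFb : F b = 0) (hv : SubAt p q F v x) (hle : ∀ᶠ y in 𝓝 x, v y ≤ b) :
    v x < b := by
  refine lt_of_le_of_ne hle.self_of_nhds fun heq => ?_
  have hU : SuperAt p q F (fun _ => b) x := by
    refine Or.inl ⟨contDiffAt_const, ?_⟩
    have : 0 < q / x ^ 2 * b := by positivity
    simp only [deriv_const', hFb]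
    linarith
  have hmin : IsLocalMin (fun y => b - v y) x := by
    filter_upwards [hle] with y hy
    rw [heq]
    linarith
  obtain ⟨-, hvC, -⟩ := hU.of_isLocalMin hv (φ := fun _ => 0) (φ' := fun _ => 0)
    (Eventually.of_forall fun y => hasDerivAt_const y 0) (hasDerivAt_const x 0) (by simpa using hmin)
  have hvle : F (v x) ≤ deriv (deriv v) x + (p / x) * deriv v x - (q / x ^ 2) * v x := by
    rcases hv with h | ⟨dl, dr, hl, hr, hlt⟩
    · exact h.2
    · have h1 := hmin.left_deriv_nonpos (hl.const_sub b)
      have h2 := hmin.right_deriv_nonneg (hr.const_sub b)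
      linarith
  obtain ⟨hv1, hv2⟩ := hvC.eventually_hasDerivAt_deriv
  have h1 := hmin.hasDerivAt_eq_zero (hv1.self_of_nhds.const_sub b)
  have h2 := hmin.nonneg_of_hasDerivAt (hv1.mono fun y hy => hy.const_sub b) hv2.neg
  have h3 : 0 < q / x ^ 2 * b := by positivity
  rw [heq, hFb, neg_eq_zero.1 h1] at hvle
  linarith

lemma exists_rpow_le {V : ℝ → ℝ} {α γ R : ℝ} (hα : 0 < α) (hγ : 0 < γ) (hR : 0 < R)
    (hVc : ContinuousOn V (Ioi 0)) (hVpos : ∀ r, 0 < r → 0 < V r)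
    (hV : Tendsto (fun r => V r / r ^ γ) (𝓝[>] 0) (𝓝 α)) :
    ∃ c > 0, ∀ r ∈ Ioc 0 R, c * r ^ γ ≤ V r := by
  obtain ⟨δ, hδ0, hδ⟩ := mem_nhdsGT_iff_exists_Ioo_subset.1
    (hV.eventually (lt_mem_nhds (half_lt_self hα)))
  rw [mem_Ioi] at hδ0
  obtain ⟨m, hm0, hm⟩ : ∃ m > 0, ∀ r ∈ Icc δ R, m ≤ V r := by
    rcases (Icc δ R).eq_empty_or_nonempty with h | h
    · exact ⟨1, one_pos, by simp [h]⟩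
    · have hsub : Icc δ R ⊆ Ioi 0 := fun r hr => hδ0.trans_le hr.1
      obtain ⟨x, hx, hmin⟩ := isCompact_Icc.exists_isMinOn h (hVc.mono hsub)
      exact ⟨V x, hVpos x (hsub hx), fun r hr => hmin hr⟩
  have hRγ : 0 < R ^ γ := Real.rpow_pos_of_pos hR γ
  refine ⟨min (α / 2) (m / R ^ γ), by positivity, fun r hr => ?_⟩
  have hrγ : 0 < r ^ γ := Real.rpow_pos_of_pos hr.1 γ
  rcases lt_or_ge r δ with h | h
  · have h1 : α / 2 < V r / r ^ γ := hδ ⟨hr.1, h⟩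
    rw [lt_div_iff₀ hrγ] at h1
    exact (mul_le_mul_of_nonneg_right (min_le_left _ _) hrγ.le).trans h1.le
  · calc min (α / 2) (m / R ^ γ) * r ^ γ ≤ m / R ^ γ * R ^ γ := by
          gcongr
          · exact min_le_right _ _
          · exact hr.1.le
          · exact hr.2
      _ = m := div_mul_cancel₀ _ hRγ.ne'
      _ ≤ V r := hm r ⟨h, hr.2⟩

lemma exists_le_rpow {v : ℝ → ℝ} {α γ R b : ℝ} (hγ : 0 < γ) (hb : 0 ≤ b)
    (hvb : ∀ r ∈ Ioo 0 R, v r ≤ b)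
    (hv : Tendsto (fun r => v r / r ^ γ) (𝓝[>] 0) (𝓝 α)) :
    ∃ C, ∀ r ∈ Ioo 0 R, v r ≤ C * r ^ γ := by
  obtain ⟨δ, hδ0, hδ⟩ := mem_nhdsGT_iff_exists_Ioo_subset.1
    (hv.eventually (gt_mem_nhds (lt_add_one α)))
  rw [mem_Ioi] at hδ0
  have hδγ : 0 < δ ^ γ := Real.rpow_pos_of_pos hδ0 γ
  refine ⟨max (α + 1) (b / δ ^ γ), fun r hr => ?_⟩
  have hrγ : 0 < r ^ γ := Real.rpow_pos_of_pos hr.1 γ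
  rcases lt_or_ge r δ with h | h
  · have h1 : v r / r ^ γ < α + 1 := hδ ⟨hr.1, h⟩
    rw [div_lt_iff₀ hrγ] at h1
    exact h1.le.trans (mul_le_mul_of_nonneg_right (le_max_left _ _) hrγ.le)
  · calc v r ≤ b := hvb r hr
      _ = b / δ ^ γ * δ ^ γ := (div_mul_cancel₀ _ hδγ.ne').symm
      _ ≤ b / δ ^ γ * r ^ γ := by gcongr
      _ ≤ _ := mul_le_mul_of_nonneg_right (le_max_right _ _) hrγ.le

/-- If a dilate of `V` lies strictly above `v`, including to leading order at `0`, then so do all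
nearby dilates. -/
lemma eventually_forall_le_dilate {V v : ℝ → ℝ} {α α' γ R b c : ℝ} (hγ : 0 < γ)
    (hc : 1 < c) (hR : 0 < R) (hVc : ContinuousOn V (Ioi 0)) (hvc : ContinuousOn v (Ioo 0 R))
    (hVR : ∀ r, R ≤ r → V r = b) (hvb : ∀ r ∈ Ioo 0 R, v r ≤ b)
    (hV : Tendsto (fun r => V r / r ^ γ) (𝓝[>] 0) (𝓝 α))
    (hv : Tendsto (fun r => v r / r ^ γ) (𝓝[>] 0) (𝓝 α'))
    (hlt : ∀ r ∈ Ioo 0 R, v r < V (c * r)) (hα : α' < α * c ^ γ) :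
    ∀ᶠ t in 𝓝 c, ∀ r ∈ Ioo 0 R, v r ≤ V (t * r) := by
  have hc0 : 0 < c := by linarith
  have hcγ : 0 < c ^ γ := Real.rpow_pos_of_pos hc0 γ
  obtain ⟨A', hA'1, hA'2⟩ := exists_between hα
  obtain ⟨A, hA1, hA2⟩ := exists_between ((div_lt_iff₀ hcγ).2 hA'2)
  rw [div_lt_iff₀ hcγ] at hA1
  obtain ⟨δ, hδ0, hδ⟩ := mem_nhdsGT_iff_exists_Ioo_subset.1
    ((hV.eventually (lt_mem_nhds hA2)).and (hv.eventually (gt_mem_nhds hA'1)))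
  rw [mem_Ioi] at hδ0
  set μ := (1 + c) / 2 with hμ
  have hμ1 : 1 < μ := by linarith
  have hμc : μ < c := by linarith
  have hcomp : ∀ᶠ t in 𝓝 c, ∀ r ∈ Icc (δ / (2 * c)) (R / μ), v r < V (t * r) := by
    refine isCompact_Icc.eventually_forall_of_forall_eventually fun r hr => ?_
    have hr0 : 0 < r := lt_of_lt_of_le (by positivity) hr.1
    have hrR : r < R := hr.2.trans_lt (div_lt_self hR hμ1)
    have h1 : ContinuousAt (fun z : ℝ × ℝ => v z.2) (c, r) :=
      ContinuousAt.comp (g := v) (hvc.continuousAt (isOpen_Ioo.mem_nhds ⟨hr0, hrR⟩))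
        continuousAt_snd
    have h2 : ContinuousAt (fun z : ℝ × ℝ => V (z.1 * z.2)) (c, r) :=
      ContinuousAt.comp (g := V) (f := fun z : ℝ × ℝ => z.1 * z.2)
        (hVc.continuousAt (isOpen_Ioi.mem_nhds (mul_pos hc0 hr0))) (by fun_prop)
    exact h1.eventually_lt h2 (hlt r ⟨hr0, hrR⟩)
  have hpow : ∀ᶠ t : ℝ in 𝓝 c, A' < A * t ^ γ :=
    (continuousAt_const.mul (Real.continuousAt_rpow_const c γ (Or.inr hγ.le))).eventually
      (lt_mem_nhds hA1)
  filter_upwards [hcomp, hpow, Ioo_mem_nhds hμc (show c < 2 * c by linarith)] with t ht1 ht2 ht3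
    r hr
  have ht0 : 0 < t := by linarith [ht3.1]
  rcases lt_or_ge r (δ / (2 * c)) with h | h
  · rw [lt_div_iff₀ (by positivity)] at h
    have hrγ : 0 < r ^ γ := Real.rpow_pos_of_pos hr.1 γ
    have htr : t * r < δ := by nlinarith [ht3.2, hr.1]
    have hrδ : r < δ := by nlinarith [hr.1]
    have h1 : A < V (t * r) / (t * r) ^ γ := (hδ ⟨mul_pos ht0 hr.1, htr⟩).1
    have h2 : v r / r ^ γ < A' := (hδ ⟨hr.1, hrδ⟩).2
    rw [lt_div_iff₀ (Real.rpow_pos_of_pos (mul_pos ht0 hr.1) γ),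
      Real.mul_rpow ht0.le hr.1.le] at h1
    rw [div_lt_iff₀ hrγ] at h2
    have h3 := mul_lt_mul_of_pos_right ht2 hrγ
    linarith
  · rcases le_or_gt r (R / μ) with h' | h'
    · exact (ht1 r ⟨h, h'⟩).le
    · rw [hVR]
      · exact hvb r hr
      · rw [div_lt_iff₀ (by linarith)] at h'
        nlinarith [ht3.1, hr.1]

/-- comparison principle on a bounded interval `(0,R)`. -/
theorem stmt8 (p q sp : ℝ) (hp : 0 ≤ p) (hq : 0 < q) (hsp : 0 < sp)
    (F : ℝ → ℝ) (hF : CondF F sp)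
    (R : ℝ) (hR : 0 < R)
    (ub lb : ℝ → ℝ) (αb αl : ℝ)
    (hsuper : IsSuperSolutionOn p q F (Set.Ioo 0 R) ub)
    (hsub : IsSubSolutionOn p q F (Set.Ioo 0 R) lb)
    (hubc : ContinuousWithinAt ub (Set.Iio R) R)
    (hlbc : ContinuousWithinAt lb (Set.Iio R) R)
    (hubnd : ∀ r ∈ Set.Ioo (0:ℝ) R, 0 ≤ ub r ∧ ub r ≤ sp)
    (hlbnd : ∀ r ∈ Set.Ioo (0:ℝ) R, 0 ≤ lb r ∧ lb r ≤ sp)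
    (hαb : 0 < αb)
    (h0ub : AsympZero ub αb (gammaPlus p q))
    (h0lb : AsympZero lb αl (gammaPlus p q))
    (hubR : ub R = sp) (hlbR : lb R ≤ sp) :
    (∀ r ∈ Set.Ioo (0:ℝ) R, lb r ≤ ub r) ∧
      (∀ r₀ ∈ Set.Ioo (0:ℝ) R, ub r₀ = lb r₀ → ∀ r ∈ Set.Ioo (0:ℝ) R, ub r = lb r) := by
  obtain ⟨hFC, hF0, hFsp, hFneg, -, -⟩ := hF
  set γ := gammaPlus p q with hγdef
  have hγ : 0 < γ := gammaPlus_pos hq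
  have hγeq : γ ^ 2 + (p - 1) * γ - q = 0 := gammaPlus_eq hq
  obtain ⟨K, hK0, hK⟩ := hFC.exists_sub_le_mul_sub sp
  have hFle : ∀ t, 0 ≤ t → t ≤ sp → F t ≤ 0 := by
    intro t h0 h1
    rcases h0.eq_or_lt with rfl | h0
    · exact hF0.le
    rcases h1.eq_or_lt with rfl | h1
    · exact hFsp.le
    · exact (hFneg t ⟨h0, h1⟩).le
  have hubC : ContinuousOn ub (Ioo 0 R) := hsuper.1.continuousOn
  have hlbC : ContinuousOn lb (Ioo 0 R) := hsub.1.continuousOn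
  have hU : ∀ x ∈ Ioo 0 R, SuperAt p q F ub x := fun x hx => hsuper.superAt hx
  have hv : ∀ x ∈ Ioo 0 R, SubAt p q F lb x := fun x hx => hsub.subAt hx
  have hubpos : ∀ r ∈ Ioo 0 R, 0 < ub r := by
    intro z hz
    refine lt_of_le_of_ne (hubnd z hz).1 fun h0 => ?_
    have hzero : ∀ a ∈ Ioo 0 R, ub a = 0 := fun a ha =>
      eq_of_touch (v := fun _ => 0) hp hq hK0 hubC continuousOn_const hU
        (fun x _ => Or.inl ⟨contDiffAt_const, by simp [hF0]⟩)
        (fun x hx => hK _ _ le_rfl (hubnd x hx).1 (hubnd x hx).2)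
        (fun x hx => (hubnd x hx).1) hz h0.symm ha
    obtain ⟨r, hr1, hr2⟩ := ((h0ub.tendsto_div.eventually (lt_mem_nhds hαb)).and
      (Ioo_mem_nhdsGT hR)).exists
    simp [hzero r hr2] at hr1
  have hlblt : ∀ r ∈ Ioo 0 R, lb r < sp := fun r hr =>
    (hv r hr).lt_of_eventually_le hq hsp hr.1 hFsp
      (eventually_of_mem (isOpen_Ioo.mem_nhds hr) fun y hy => (hlbnd y hy).2)
  set V : ℝ → ℝ := fun r => ub (min r R) with hVdef
  have hVlt : ∀ r, r < R → V r = ub r := fun r hr => by simp only [hVdef, min_eq_left hr.le]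
  have hVge : ∀ r, R ≤ r → V r = sp := fun r hr => by simp only [hVdef, min_eq_right hr, hubR]
  have hVC : ContinuousOn V (Ioi 0) := by
    have h1 : ContinuousOn ub (Ioc 0 R) := by
      intro x hx
      rcases hx.2.eq_or_lt with rfl | hlt
      · have : ContinuousWithinAt ub (Iic x) x := by
          rw [← Iio_insert]
          exact continuousWithinAt_insert_self.2 hubc
        exact this.mono Ioc_subset_Iic_self
      · exact (hubC.continuousAt (isOpen_Ioo.mem_nhds ⟨hx.1, hlt⟩)).continuousWithinAt
    exact h1.comp (f := fun r => min r R) (by fun_prop)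
      fun r hr => ⟨lt_min hr hR, min_le_right _ _⟩
  have hVpos : ∀ r, 0 < r → 0 < V r := by
    intro r hr
    rcases lt_or_ge r R with h | h
    · rw [hVlt r h]; exact hubpos r ⟨hr, h⟩
    · rw [hVge r h]; exact hsp
  have hVlim : Tendsto (fun r => V r / r ^ γ) (𝓝[>] 0) (𝓝 αb) := by
    refine h0ub.tendsto_div.congr' ?_
    filter_upwards [Ioo_mem_nhdsGT hR] with r hr
    rw [hVlt r hr.2]
  have hlim := h0lb.tendsto_div
  set A : Set ℝ := {c | ∀ r ∈ Ioo 0 R, lb r ≤ V (c * r)} with hA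
  have hclos : ∀ c, 0 < c → c ∈ closure A → c ∈ A := by
    intro c hc hcA r hr
    have hcont : ContinuousAt (fun t => V (t * r)) c :=
      ContinuousAt.comp (g := V) (hVC.continuousAt (isOpen_Ioi.mem_nhds (mul_pos hc hr.1)))
        (by fun_prop)
    by_contra! hlt
    obtain ⟨t, ht, htA⟩ := mem_closure_iff_nhds.1 hcA _ (hcont.eventually (gt_mem_nhds hlt))
    exact absurd (htA r hr) (not_le.2 ht)
  have hopen : ∀ c, 1 < c → c ∈ A → A ∈ 𝓝 c := by
    intro c hc hcA
    have hc0 : 0 < c := by linarith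
    have hmem : ∀ r ∈ Ioo 0 (R / c), c * r ∈ Ioo 0 R := fun r hr =>
      ⟨mul_pos hc0 hr.1, by rw [mul_comm]; exact (lt_div_iff₀ hc0).1 hr.2⟩
    have hρ : 0 < R / c := by positivity
    have hρR : R / c < R := div_lt_self hR hc
    have hsub' : Ioo 0 (R / c) ⊆ Ioo 0 R := Ioo_subset_Ioo_right hρR.le
    have hUc' : ContinuousOn (fun r => ub (c * r)) (Ioo 0 (R / c)) :=
      hubC.comp (by fun_prop) hmem
    have hU' : ∀ x ∈ Ioo 0 (R / c), SuperAt p q F (fun r => ub (c * r)) x := fun x hx =>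
      (hU _ (hmem x hx)).dilate hc.le hx.1
        (hFle _ (hubnd _ (hmem x hx)).1 (hubnd _ (hmem x hx)).2)
    have hle' : ∀ x ∈ Ioo 0 (R / c), lb x ≤ ub (c * x) := fun x hx => by
      rw [← hVlt _ (hmem x hx).2]
      exact hcA x (hsub' hx)
    have hK' : ∀ x ∈ Ioo 0 (R / c), F (ub (c * x)) - F (lb x) ≤ K * (ub (c * x) - lb x) :=
      fun x hx => hK _ _ (hlbnd x (hsub' hx)).1 (hle' x hx) (hubnd _ (hmem x hx)).2
    have hlt' : ∀ x ∈ Ioo 0 (R / c), lb x < ub (c * x) := by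
      intro z hz
      refine lt_of_le_of_ne (hle' z hz) fun heq => ?_
      have hall : ∀ a ∈ Ioo 0 (R / c), V (c * a) = lb a := fun a ha => by
        rw [hVlt _ (hmem a ha).2]
        exact eq_of_touch (U := fun r => ub (c * r)) hp hq hK0 hUc' (hlbC.mono hsub') hU'
          (fun x hx => hv x (hsub' hx)) hK' hle' hz heq.symm ha
      have hVcont : ContinuousAt (fun r => V (c * r)) (R / c) :=
        ContinuousAt.comp (g := V) (hVC.continuousAt (isOpen_Ioi.mem_nhds (mul_pos hc0 hρ)))
          (by fun_prop)
      have hend : V (c * (R / c)) = sp := hVge _ (mul_div_cancel₀ R hc0.ne').ge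
      have hlt : lb (R / c) < V (c * (R / c)) := by rw [hend]; exact hlblt _ ⟨hρ, hρR⟩
      have hev := (hlbC.continuousAt (isOpen_Ioo.mem_nhds ⟨hρ, hρR⟩)).eventually_lt hVcont hlt
      obtain ⟨r, hr1, hr2⟩ := ((hev.filter_mono nhdsWithin_le_nhds).and
        (Ioo_mem_nhdsLT hρ)).exists
      exact hr1.ne (hall r hr2).symm
    obtain ⟨ε, hε0, hε⟩ := exists_rpow_le_sub (U := fun r => ub (c * r)) hp hq hK0 hρ hγ hγeq hUc'
      (hlbC.mono hsub') hU' (fun x hx => hv x (hsub' hx)) hK' hlt'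
    have hα : αl < αb * c ^ γ := by
      have h1 : ε ≤ αb * c ^ γ - αl := by
        refine ge_of_tendsto ((h0ub.tendsto_comp_mul_div hc0).sub hlim) ?_
        filter_upwards [hε, self_mem_nhdsWithin] with r hr hr0
        rw [← sub_div, le_div_iff₀ (Real.rpow_pos_of_pos hr0 γ)]
        exact hr
      linarith
    refine eventually_forall_le_dilate hγ hc hR hVC hlbC hVge (fun r hr => (hlbnd r hr).2)
      hVlim hlim (fun r hr => ?_) hα
    rcases lt_or_ge r (R / c) with h | h
    · rw [hVlt _ (hmem r ⟨hr.1, h⟩).2]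
      exact hlt' r ⟨hr.1, h⟩
    · rw [hVge]
      · exact hlblt r hr
      · rw [mul_comm]
        exact (div_le_iff₀ hc0).1 h
  have hne : (Ioi 1 ∩ A).Nonempty := by
    obtain ⟨k, hk0, hk⟩ := exists_rpow_le hαb hγ hR hVC hVpos hVlim
    obtain ⟨C, hC⟩ := exists_le_rpow hγ hsp.le (fun r hr => (hlbnd r hr).2) hlim
    obtain ⟨c, hc1, hc2⟩ := (((tendsto_rpow_atTop hγ).eventually_ge_atTop (C / k)).and
      (eventually_gt_atTop 1)).exists
    refine ⟨c, hc2, fun r hr => ?_⟩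
    have hc0 : 0 < c := by linarith
    rcases le_or_gt (c * r) R with h | h
    · have h1 := hk (c * r) ⟨mul_pos hc0 hr.1, h⟩
      rw [Real.mul_rpow hc0.le hr.1.le] at h1
      rw [div_le_iff₀ hk0] at hc1
      have h2 := mul_le_mul_of_nonneg_right hc1 (Real.rpow_nonneg hr.1.le γ)
      linarith [hC r hr]
    · rw [hVge _ h.le]
      exact (hlbnd r hr).2
  have hall : Ioi 1 ⊆ A := by
    have h1 : Ioi (1 : ℝ) ⊆ interior (A ∩ Ioi 1) := by
      refine isPreconnected_Ioi.subset_of_closure_inter_subset isOpen_interior ?_ ?_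
      · obtain ⟨c, hc, hcA⟩ := hne
        exact ⟨c, hc, mem_interior_iff_mem_nhds.2 (inter_mem (hopen c hc hcA) (Ioi_mem_nhds hc))⟩
      · rintro c ⟨hcl, hc⟩
        have hcA : c ∈ A := hclos c (one_pos.trans hc)
          (closure_mono (interior_subset.trans inter_subset_left) hcl)
        exact mem_interior_iff_mem_nhds.2 (inter_mem (hopen c hc hcA) (Ioi_mem_nhds hc))
    exact h1.trans (interior_subset.trans inter_subset_left)
  have hle : ∀ r ∈ Ioo 0 R, lb r ≤ ub r := by
    intro r hr
    have h1 : (1 : ℝ) ∈ A := hclos 1 one_pos (closure_mono hall (by simp [closure_Ioi]))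
    have h2 := h1 r hr
    rwa [one_mul, hVlt r hr.2] at h2
  exact ⟨hle, fun z hz heq r hr => eq_of_touch hp hq hK0 hubC hlbC hU hv
    (fun x hx => hK _ _ (hlbnd x hx).1 (hle x hx) (hubnd x hx).2) hle hz heq hr⟩
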